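/- Fix an odd integer d = 2m + 1 ≥ 5. Then m + 2 is a typical rank for real bivariate homogeneous forms of degree d. -/

import Mathlib

/-!
We model the space `K[x,y]_d` of degree-`d` homogeneous bivariate forms over `K`
by its coefficient vectors `Fin (d+1) → K`, where `f i` is the coefficient of
`x^i * y^(d-i)`.  A linear form `p*x + q*y ∈ K[x,y]_1` is modeled by the pair
`(p, q) : K × K`; `powVec d (p,q)` is the coefficient vector of `(p*x + q*y)^d`.
-/

/-- Coefficient vector of `(p*x + q*y)^d` in the basis `x^i y^(d-i)`. -/
noncomputable def powVec {K : Type*} [CommRing K] (d : ℕ) (L : K × K) :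
    Fin (d + 1) → K :=
  fun i => (d.choose (i : ℕ) : K) * L.1 ^ (i : ℕ) * L.2 ^ (d - (i : ℕ))

/-- The rank over `K` of a degree-`d` form: the minimal `r` such that
`f = ∑_{i=1}^r c_i L_i^d` with `c_i ∈ K` and linear forms `L_i ∈ K[x,y]_1`. -/
noncomputable def rankK (K : Type*) [CommRing K] (d : ℕ) (f : Fin (d + 1) → K) : ℕ :=
  sInf {r : ℕ | ∃ (c : Fin r → K) (L : Fin r → K × K), f = ∑ i, c i • powVec d (L i)}

/-- The real rank `Rsr` of a real binary form of degree `d`. -/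
noncomputable def Rsr (d : ℕ) (f : Fin (d + 1) → ℝ) : ℕ := rankK ℝ d f

/-- The complex rank `Csr` of a complex binary form of degree `d`. -/
noncomputable def Csr (d : ℕ) (f : Fin (d + 1) → ℂ) : ℕ := rankK ℂ d f

/-- A real form regarded as a complex form (coefficientwise inclusion `ℝ ↪ ℂ`). -/
noncomputable def complexify {d : ℕ} (f : Fin (d + 1) → ℝ) : Fin (d + 1) → ℂ :=
  fun i => (f i : ℂ)

/-- `t` is a typical rank in degree `d`: there is a nonempty euclidean-open set of
real degree-`d` forms on which the real rank is constantly `t`. -/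
def IsTypicalRank (d t : ℕ) : Prop :=
  ∃ V : Set (Fin (d + 1) → ℝ), IsOpen V ∧ V.Nonempty ∧ ∀ f ∈ V, Rsr d f = t

/-- Two linear forms (modeled as coefficient pairs) are proportional if one is a
scalar multiple of the other. -/
def AreProportional {K : Type*} [CommRing K] (u v : K × K) : Prop :=
  ∃ t : K, v = t • u ∨ u = t • v

open Polynomial Topology Filter

/-- The apolarity pairing of a degree-`d` form with a univariate polynomial, normalized so that
`(p x + q y)^d` pairs with `P` to the value at `(p, q)` of the degree-`d` homogenization of `P`. -/
noncomputable def apolarPairing (d : ℕ) (f : Fin (d + 1) → ℝ) (P : ℝ[X]) : ℝ :=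
  ∑ i : Fin (d + 1), f i / (d.choose (i : ℕ) : ℝ) * P.coeff i

lemma apolarPairing_powVec (d : ℕ) (L : ℝ × ℝ) (P : ℝ[X]) :
    apolarPairing d (powVec d L) P =
      ∑ k ∈ Finset.range (d + 1), P.coeff k * L.1 ^ k * L.2 ^ (d - k) := by
  rw [Finset.sum_range]
  refine Finset.sum_congr rfl fun i _ => ?_
  have h : (d.choose (i : ℕ) : ℝ) ≠ 0 := by
    exact_mod_cast (Nat.choose_pos (Nat.lt_succ_iff.mp i.2)).ne'
  simp only [powVec]
  field_simp

lemma apolarPairing_sum_smul (d : ℕ) {ι : Type*} [Fintype ι] (c : ι → ℝ)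
    (v : ι → Fin (d + 1) → ℝ) (P : ℝ[X]) :
    apolarPairing d (∑ j, c j • v j) P = ∑ j, c j * apolarPairing d (v j) P := by
  simp only [apolarPairing, Finset.sum_apply, Pi.smul_apply, smul_eq_mul, Finset.mul_sum,
    Finset.sum_div, Finset.sum_mul]
  rw [Finset.sum_comm]
  exact Finset.sum_congr rfl fun j _ => Finset.sum_congr rfl fun i _ => by ring

lemma apolarPairing_powVec_one (d : ℕ) (t : ℝ) (P : ℝ[X]) (hP : P.natDegree ≤ d) :
    apolarPairing d (powVec d (t, 1)) P = P.eval t := by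
  rw [apolarPairing_powVec, eval_eq_sum_range' (Nat.lt_succ_of_le hP)]
  simp

lemma apolarPairing_powVec_linear_mul (n : ℕ) (L : ℝ × ℝ) (p q : ℝ) (R : ℝ[X])
    (hR : R.natDegree ≤ n) (hL : q * L.1 = p * L.2) :
    apolarPairing (n + 1) (powVec (n + 1) L) ((C q * X - C p) * R) = 0 := by
  have h1 : ∑ k ∈ Finset.range (n + 2), (X * R).coeff k * L.1 ^ k * L.2 ^ (n + 1 - k) =
      L.1 * ∑ k ∈ Finset.range (n + 1), R.coeff k * L.1 ^ k * L.2 ^ (n - k) := by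
    rw [Finset.sum_range_succ', Finset.mul_sum]
    simp only [coeff_X_mul, coeff_X_mul_zero, zero_mul, add_zero, Nat.add_sub_add_right]
    exact Finset.sum_congr rfl fun k _ => by ring
  have h2 : ∑ k ∈ Finset.range (n + 2), R.coeff k * L.1 ^ k * L.2 ^ (n + 1 - k) =
      L.2 * ∑ k ∈ Finset.range (n + 1), R.coeff k * L.1 ^ k * L.2 ^ (n - k) := by
    rw [Finset.sum_range_succ, coeff_eq_zero_of_natDegree_lt (Nat.lt_succ_of_le hR),
      Finset.mul_sum]
    simp only [zero_mul, add_zero]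
    refine Finset.sum_congr rfl fun k hk => ?_
    rw [Nat.succ_sub (Nat.lt_succ_iff.mp (Finset.mem_range.mp hk)), pow_succ]
    ring
  rw [apolarPairing_powVec]
  have h3 : ∀ k, ((C q * X - C p) * R).coeff k = q * (X * R).coeff k - p * R.coeff k := by
    intro k
    rw [sub_mul, mul_assoc, coeff_sub, coeff_C_mul, coeff_C_mul]
  calc _ = q * ∑ k ∈ Finset.range (n + 2), (X * R).coeff k * L.1 ^ k * L.2 ^ (n + 1 - k)
        - p * ∑ k ∈ Finset.range (n + 2), R.coeff k * L.1 ^ k * L.2 ^ (n + 1 - k) := by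
        rw [Finset.mul_sum, Finset.mul_sum, ← Finset.sum_sub_distrib]
        exact Finset.sum_congr rfl fun k _ => by rw [h3]; ring
    _ = 0 := by
        rw [h1, h2]
        linear_combination (∑ k ∈ Finset.range (n + 1), R.coeff k * L.1 ^ k * L.2 ^ (n - k)) * hL

/-- The dehomogenized totally real form vanishing at the given points of the projective line. -/
noncomputable def totallyReal {ι : Type*} (s : Finset ι) (z : ι → Circle) : ℝ[X] :=
  ∏ j ∈ s, (C (z j : ℂ).im * X - C (z j : ℂ).re)

lemma natDegree_totallyReal_le {ι : Type*} (s : Finset ι) (z : ι → Circle) :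
    (totallyReal s z).natDegree ≤ s.card := by
  refine (natDegree_prod_le _ _).trans ?_
  calc _ ≤ ∑ _j ∈ s, 1 := Finset.sum_le_sum fun j _ => by compute_degree
    _ = s.card := by simp

lemma continuous_coeff_totallyReal {ι : Type*} (s : Finset ι) (k : ℕ) :
    Continuous fun z : ι → Circle => (totallyReal s z).coeff k := by
  classical
  induction s using Finset.induction_on generalizing k with
  | empty => simpa [totallyReal] using continuous_const
  | insert a s ha ih =>
    have h : ∀ z : ι → Circle, (totallyReal (insert a s) z).coeff k =
        (z a : ℂ).im * (X * totallyReal s z).coeff k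
          - (z a : ℂ).re * (totallyReal s z).coeff k := by
      intro z
      rw [totallyReal, Finset.prod_insert ha, sub_mul, mul_assoc, coeff_sub, coeff_C_mul,
        coeff_C_mul, totallyReal]
    simp only [h]
    have him : Continuous fun z : ι → Circle => (z a : ℂ).im :=
      by fun_prop
    have hre : Continuous fun z : ι → Circle => (z a : ℂ).re :=
      by fun_prop
    cases k with
    | zero =>
      simp only [coeff_X_mul_zero, mul_zero, zero_sub]
      exact (hre.mul (ih 0)).neg
    | succ k =>
      simp only [coeff_X_mul]
      exact (him.mul (ih k)).sub (hre.mul (ih (k + 1)))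

lemma totallyReal_aeval_I_ne_zero {ι : Type*} (s : Finset ι) (z : ι → Circle) :
    aeval Complex.I (totallyReal s z) ≠ 0 := by
  rw [totallyReal, map_prod]
  refine Finset.prod_ne_zero_iff.mpr fun j _ h => ?_
  have h1 := congrArg Complex.re h
  have h2 := congrArg Complex.im h
  simp at h1 h2
  exact (z j).coe_ne_zero (Complex.ext h1 h2)

/-- The forms of degree `d` apolar to the multiples `X^i * G`, `i ≤ m`, of a totally real `G` with
`r` roots. -/
def totallyRealApolar (d m r : ℕ) : Set (Fin (d + 1) → ℝ) :=
  {f | ∃ z : Fin r → Circle, ∀ i ∈ Finset.range (m + 1),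
    apolarPairing d f (X ^ i * totallyReal Finset.univ z) = 0}

lemma isClosed_totallyRealApolar (d m r : ℕ) : IsClosed (totallyRealApolar d m r) := by
  have h : IsClosed {w : (Fin r → Circle) × (Fin (d + 1) → ℝ) | ∀ i ∈ Finset.range (m + 1),
      apolarPairing d w.2 (X ^ i * totallyReal Finset.univ w.1) = 0} := by
    simp only [Set.ofPred_forall]
    refine isClosed_iInter fun i => isClosed_iInter fun _ => ?_
    refine isClosed_eq ?_ continuous_const
    unfold apolarPairing
    refine continuous_finsetSum _ fun k _ => ?_
    refine Continuous.mul (by fun_prop) ?_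
    simp only [coeff_X_pow_mul']
    split_ifs
    · exact (continuous_coeff_totallyReal _ _).fst'
    · exact continuous_const
  convert isClosedMap_snd_of_compactSpace _ h using 1
  ext f
  simp [totallyRealApolar]

lemma exists_circle_smul (L : ℝ × ℝ) :
    ∃ (z : Circle) (s : ℝ), L.1 = s * (z : ℂ).re ∧ L.2 = s * (z : ℂ).im := by
  refine ⟨Circle.exp (Complex.arg ⟨L.1, L.2⟩), ‖(⟨L.1, L.2⟩ : ℂ)‖, ?_⟩
  have h := Complex.norm_mul_exp_arg_mul_I ⟨L.1, L.2⟩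
  rw [← Circle.coe_exp] at h
  have h1 := congrArg Complex.re h
  have h2 := congrArg Complex.im h
  rw [Complex.re_ofReal_mul] at h1
  rw [Complex.im_ofReal_mul] at h2
  exact ⟨h1.symm, h2.symm⟩

lemma sum_powVec_mem_totallyRealApolar (n m r : ℕ) (hr : m + r ≤ n + 1) (c : Fin r → ℝ)
    (L : Fin r → ℝ × ℝ) :
    ∑ j, c j • powVec (n + 1) (L j) ∈ totallyRealApolar (n + 1) m r := by
  choose z s hz using fun j => exists_circle_smul (L j)
  refine ⟨z, fun i hi => ?_⟩
  rw [apolarPairing_sum_smul]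
  refine Finset.sum_eq_zero fun j _ => ?_
  have hG : X ^ i * totallyReal Finset.univ z = (C (z j : ℂ).im * X - C (z j : ℂ).re) *
      (X ^ i * totallyReal (Finset.univ.erase j) z) := by
    rw [totallyReal, ← Finset.mul_prod_erase _ _ (Finset.mem_univ j), totallyReal]
    ring
  rw [hG, apolarPairing_powVec_linear_mul, mul_zero]
  · refine natDegree_mul_le.trans ?_
    have h1 := natDegree_totallyReal_le (Finset.univ.erase j) z
    rw [Finset.card_erase_of_mem (Finset.mem_univ j), Finset.card_fin] at h1
    rw [natDegree_X_pow]
    have := Finset.mem_range.mp hi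
    have := j.pos
    omega
  · rw [(hz j).1, (hz j).2]
    ring

/-- A vector orthogonal to all polynomials of degree at most `m` on `m + 2` nodes is proportional
to the vector of nodal weights. -/
lemma exists_eq_mul_nodalWeight (m : ℕ) (t : Fin (m + 2) → ℝ) (ht : Function.Injective t)
    (v : Fin (m + 2) → ℝ)
    (hv : ∀ P : ℝ[X], P.natDegree ≤ m → ∑ j, v j * P.eval (t j) = 0) :
    ∃ a : ℝ, ∀ j, v j = a * Lagrange.nodalWeight Finset.univ t j := by
  have hw : ∀ j, Lagrange.nodalWeight Finset.univ t j ≠ 0 := fun j =>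
    Lagrange.nodalWeight_ne_zero ht.injOn (Finset.mem_univ j)
  refine ⟨v 0 / Lagrange.nodalWeight Finset.univ t 0, fun j => ?_⟩
  rcases eq_or_ne j 0 with rfl | hj
  · exact (div_mul_cancel₀ _ (hw 0)).symm
  have hS0 : (0 : Fin (m + 2)) ∈ Finset.univ.erase j := by simp [hj.symm]
  have hSj : j ∈ Finset.univ.erase (0 : Fin (m + 2)) := by simp [hj]
  set S := (Finset.univ.erase j).erase (0 : Fin (m + 2)) with hS
  have hS' : S = (Finset.univ.erase (0 : Fin (m + 2))).erase j := Finset.erase_right_comm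
  have hdeg : (Lagrange.nodal S t).natDegree ≤ m := by
    rw [Lagrange.natDegree_nodal, hS, Finset.card_erase_of_mem hS0,
      Finset.card_erase_of_mem (Finset.mem_univ j), Finset.card_fin]
    omega
  have hsum := hv _ hdeg
  have hwj : Lagrange.nodalWeight Finset.univ t j * ((t j - t 0) * (Lagrange.nodal S t).eval (t j))
      = 1 := by
    rw [Lagrange.nodalWeight, Lagrange.eval_nodal, hS,
      Finset.mul_prod_erase (Finset.univ.erase j) (fun k => t j - t k) hS0,
      ← Finset.prod_mul_distrib]
    refine Finset.prod_eq_one fun k hk => inv_mul_cancel₀ ?_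
    exact sub_ne_zero.mpr fun h => (Finset.ne_of_mem_erase hk) (ht h).symm
  have hw0 : Lagrange.nodalWeight Finset.univ t 0 * ((t 0 - t j) * (Lagrange.nodal S t).eval (t 0))
      = 1 := by
    rw [Lagrange.nodalWeight, Lagrange.eval_nodal, hS',
      Finset.mul_prod_erase (Finset.univ.erase 0) (fun k => t 0 - t k) hSj,
      ← Finset.prod_mul_distrib]
    refine Finset.prod_eq_one fun k hk => inv_mul_cancel₀ ?_
    exact sub_ne_zero.mpr fun h => (Finset.ne_of_mem_erase hk) (ht h).symm
  rw [← Finset.add_sum_erase _ _ (Finset.mem_univ j), ← Finset.add_sum_erase _ _ hS0,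
    Finset.sum_eq_zero (s := S), add_zero] at hsum
  · rw [div_mul_eq_mul_div, eq_div_iff (hw 0)]
    linear_combination (Lagrange.nodalWeight Finset.univ t 0 * Lagrange.nodalWeight Finset.univ t j
      * (t j - t 0)) * hsum - Lagrange.nodalWeight Finset.univ t 0 * v j * hwj
      + Lagrange.nodalWeight Finset.univ t j * v 0 * hw0
  · intro k hk
    rw [Lagrange.eval_nodal_at_node hk, mul_zero]

lemma sum_powVec_notMem_totallyRealApolar (m r : ℕ) (hm : 1 ≤ m) (hr : r ≤ m + 1)
    (t : Fin (m + 2) → ℝ) (ht : Function.Injective t) :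
    ∑ j, (Lagrange.nodalWeight Finset.univ t j / (1 + t j ^ 2)) • powVec (2 * m + 1) (t j, 1) ∉
      totallyRealApolar (2 * m + 1) m r := by
  rintro ⟨z, hz⟩
  set G := totallyReal Finset.univ z with hG
  have hGd : G.natDegree ≤ m + 1 := (natDegree_totallyReal_le _ z).trans (by simpa using hr)
  have hmon : ∀ i ∈ Finset.range (m + 1),
      ∑ j, Lagrange.nodalWeight Finset.univ t j / (1 + t j ^ 2) * (t j ^ i * G.eval (t j)) = 0 := by
    intro i hi
    rw [← hz i hi, apolarPairing_sum_smul]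
    refine Finset.sum_congr rfl fun j _ => ?_
    rw [apolarPairing_powVec_one, eval_mul, eval_pow, eval_X]
    refine natDegree_mul_le.trans ?_
    rw [natDegree_X_pow]
    have := Finset.mem_range.mp hi
    omega
  obtain ⟨a, ha⟩ := exists_eq_mul_nodalWeight m t ht
    (fun j => Lagrange.nodalWeight Finset.univ t j / (1 + t j ^ 2) * G.eval (t j)) (by
      intro P hP
      simp only [eval_eq_sum_range' (Nat.lt_succ_of_le hP), Finset.mul_sum]
      rw [Finset.sum_comm]
      refine Finset.sum_eq_zero fun i hi => ?_
      calc _ = P.coeff i * ∑ j, Lagrange.nodalWeight Finset.univ t j / (1 + t j ^ 2) *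
            (t j ^ i * G.eval (t j)) := by
            rw [Finset.mul_sum]
            refine Finset.sum_congr rfl fun j _ => ?_
            ring
        _ = 0 := by rw [hmon i hi, mul_zero])
  have hev : ∀ j, G.eval (t j) = (C a * (X ^ 2 + 1)).eval (t j) := by
    intro j
    have h1 : (1 + t j ^ 2) ≠ 0 := by positivity
    have h2 := Lagrange.nodalWeight_ne_zero (s := Finset.univ) ht.injOn (Finset.mem_univ j)
    have h3 := ha j
    simp only [div_mul_eq_mul_div, div_eq_iff h1] at h3
    apply mul_left_cancel₀ h2
    rw [h3]
    simp
    ring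
  have hGeq : G = C a * (X ^ 2 + 1) := by
    refine Polynomial.eq_of_degrees_lt_of_eval_index_eq Finset.univ (v := t) ht.injOn ?_ ?_
      fun j _ => hev j
    · refine lt_of_le_of_lt degree_le_natDegree ?_
      rw [Finset.card_fin]
      exact_mod_cast Nat.lt_succ_of_le hGd
    · refine lt_of_le_of_lt (b := (2 : WithBot ℕ)) (by compute_degree) ?_
      rw [Finset.card_fin]
      exact_mod_cast (by omega : 2 < m + 2)
  apply totallyReal_aeval_I_ne_zero Finset.univ z
  rw [← hG, hGeq]
  simp

/-- A polynomial with too many double roots vanishes. -/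
lemma eq_zero_of_double_roots {n : ℕ} (t : Fin n → ℝ) (ht : Function.Injective t) (P : ℝ[X])
    (hP : P.natDegree < 2 * n) (h0 : ∀ j, P.eval (t j) = 0)
    (h1 : ∀ j, P.derivative.eval (t j) = 0) : P = 0 := by
  by_contra hne
  have hdvd : ∏ j, (X - C (t j)) ^ 2 ∣ P := by
    refine Finset.prod_dvd_of_coprime (fun i _ j _ hij => ?_) fun j _ => ?_
    · exact (pairwise_coprime_X_sub_C ht hij).pow
    · rw [← le_rootMultiplicity_iff hne]
      exact (one_lt_rootMultiplicity_iff_isRoot hne).mpr ⟨h0 j, h1 j⟩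
  have := natDegree_le_of_dvd hdvd hne
  rw [natDegree_prod_of_monic _ _ fun j _ => (monic_X_sub_C _).pow 2] at this
  simp at this
  omega

/-- The set of sums of `n` powers is a neighbourhood of any sum with distinct nodes and nonzero
weights, provided `d < 2 * n`. -/
lemma sum_powVec_mem_nhds {d n : ℕ} (hd : d < 2 * n) (c t : Fin n → ℝ)
    (ht : Function.Injective t) (hc : ∀ j, c j ≠ 0) :
    ∀ᶠ f in 𝓝 (∑ j, c j • powVec d (t j, 1)),
      ∃ (c : Fin n → ℝ) (L : Fin n → ℝ × ℝ), f = ∑ j, c j • powVec d (L j) := by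
  let Φ : (Fin n → ℝ) × (Fin n → ℝ) → Fin (d + 1) → ℝ :=
    fun w i => ∑ j, w.1 j * ((d.choose (i : ℕ) : ℝ) * w.2 j ^ (i : ℕ))
  have hΦ : ∀ w, Φ w = ∑ j, w.1 j • powVec d (w.2 j, 1) := by
    intro w
    ext i
    simp [Φ, powVec]
  let p1 (j : Fin n) : (Fin n → ℝ) × (Fin n → ℝ) →L[ℝ] ℝ :=
    (ContinuousLinearMap.proj j).comp (ContinuousLinearMap.fst ℝ _ _)
  let p2 (j : Fin n) : (Fin n → ℝ) × (Fin n → ℝ) →L[ℝ] ℝ :=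
    (ContinuousLinearMap.proj j).comp (ContinuousLinearMap.snd ℝ _ _)
  let Φ' : (Fin n → ℝ) × (Fin n → ℝ) →L[ℝ] (Fin (d + 1) → ℝ) :=
    ContinuousLinearMap.pi fun i => ∑ j,
      (c j • ((d.choose (i : ℕ) : ℝ) • (((i : ℕ) * t j ^ ((i : ℕ) - 1)) • p2 j)) +
        ((d.choose (i : ℕ) : ℝ) * t j ^ (i : ℕ)) • p1 j)
  have hder : HasStrictFDerivAt Φ Φ' (c, t) := by
    rw [hasStrictFDerivAt_pi]
    intro i
    refine HasStrictFDerivAt.fun_sum fun j _ => ?_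
    have h1 : HasStrictFDerivAt (fun w : (Fin n → ℝ) × (Fin n → ℝ) => w.1 j) (p1 j) (c, t) :=
      (p1 j).hasStrictFDerivAt
    have h2 : HasStrictFDerivAt (fun w : (Fin n → ℝ) × (Fin n → ℝ) => w.2 j) (p2 j) (c, t) :=
      (p2 j).hasStrictFDerivAt
    exact h1.mul (((hasStrictDerivAt_pow (i : ℕ) (t j)).comp_hasStrictFDerivAt (c, t) h2).const_mul
      (d.choose (i : ℕ) : ℝ))
  have hsurj : Φ'.range = ⊤ := by
    by_contra hne
    obtain ⟨φ, hφ0, hφ⟩ := Submodule.exists_le_ker_of_lt_top _ (lt_top_iff_ne_top.mpr hne)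
    have hker : ∀ w, ∑ i : Fin (d + 1), Φ' w i * φ (Pi.single i 1) = 0 := by
      intro w
      have h : φ (Φ' w) = 0 := hφ ⟨w, rfl⟩
      rw [LinearMap.pi_apply_eq_sum_univ φ] at h
      rw [← h]
      refine Finset.sum_congr rfl fun i _ => ?_
      rw [smul_eq_mul]
      congr 2
      ext k
      simp [Pi.single_apply, eq_comm]
    let P : ℝ[X] := ∑ i : Fin (d + 1),
      C ((d.choose (i : ℕ) : ℝ) * φ (Pi.single i 1)) * X ^ (i : ℕ)
    have hP : P = 0 := by
      refine eq_zero_of_double_roots t ht P ?_ (fun j => ?_) fun j => ?_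
      · refine lt_of_le_of_lt (natDegree_sum_le_of_forall_le _ _ (n := d) fun i _ => ?_) hd
        exact (natDegree_C_mul_X_pow_le _ _).trans (Nat.lt_succ_iff.mp i.2)
      · rw [← hker (Pi.single j 1, 0)]
        simp [P, eval_finsetSum, Φ', p1, p2, Pi.single_apply]
        refine Finset.sum_congr rfl fun i _ => ?_
        ring
      · have h := hker (0, Pi.single j 1)
        apply mul_left_cancel₀ (hc j)
        rw [mul_zero, ← h]
        simp [P, eval_finsetSum, derivative_X_pow, Φ', p1, p2, Pi.single_apply, Finset.mul_sum]
        refine Finset.sum_congr rfl fun i _ => ?_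
        ring
    apply hφ0
    refine LinearMap.pi_ext' fun i => LinearMap.ext_ring ?_
    have hco : P.coeff i = (d.choose (i : ℕ) : ℝ) * φ (Pi.single i 1) := by
      simp only [P, finsetSum_coeff, coeff_C_mul_X_pow, Fin.val_inj]
      simp
    rw [hP, coeff_zero] at hco
    have hch : (d.choose (i : ℕ) : ℝ) ≠ 0 := by
      exact_mod_cast (Nat.choose_pos (Nat.lt_succ_iff.mp i.2)).ne'
    simpa [hch] using hco.symm
  have hmap := hder.map_nhds_eq_of_surj hsurj
  have h0 : Φ (c, t) = ∑ j, c j • powVec d (t j, 1) := hΦ _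
  rw [← h0, ← hmap, eventually_map]
  exact Eventually.of_forall fun w => ⟨w.1, fun j => (w.2 j, 1), hΦ w⟩

/-- For odd `d = 2m+1 ≥ 5`, the integer `m + 2` is a typical rank for real
bivariate degree-`d` forms. -/
theorem typical_rank_m_add_two (m : ℕ) (hm : 5 ≤ 2 * m + 1) :
    IsTypicalRank (2 * m + 1) (m + 2) := by
  let t : Fin (m + 2) → ℝ := fun j => ((j : ℕ) : ℝ)
  have ht : Function.Injective t := fun i j h => Fin.ext (Nat.cast_injective h)
  have hupper := sum_powVec_mem_nhds (d := 2 * m + 1) (by omega)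
    (fun j => Lagrange.nodalWeight Finset.univ t j / (1 + t j ^ 2)) t ht fun j =>
      div_ne_zero (Lagrange.nodalWeight_ne_zero ht.injOn (Finset.mem_univ j)) (by positivity)
  have hlower := (Finset.eventually_all (Finset.range (m + 2))).mpr fun r hr =>
    (isClosed_totallyRealApolar (2 * m + 1) m r).isOpen_compl.mem_nhds
      (sum_powVec_notMem_totallyRealApolar m r (by omega)
        (Nat.lt_succ_iff.mp (Finset.mem_range.mp hr)) t ht)
  obtain ⟨V, hV, hVo, hmem⟩ := eventually_nhds_iff.mp (hupper.and hlower)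
  refine ⟨V, hVo, ⟨_, hmem⟩, fun f hf => ?_⟩
  obtain ⟨hu, hl⟩ := hV f hf
  refine le_antisymm (Nat.sInf_le hu) (le_csInf ⟨_, hu⟩ ?_)
  rintro r ⟨c, L, rfl⟩
  by_contra hr
  exact hl r (Finset.mem_range.mpr (by omega))
    (sum_powVec_mem_totallyRealApolar (2 * m) m r (by omega) c L)
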